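/- Let χ > 0, assume (B) and (init), let (u, v) be the maximal classical solution of the crime model on Ω̄ × [0, T_max), and let q ∈ (0,1). Then for each T > 0 there exists C(T) > 0 such that, with T̂_max := min{T, T_max} and τ := min{1, T_max/3}, ∫_t^{t+τ} ∫_Ω v^{q−2} (v_x)² ≤ C(T) for all t ∈ (0, T̂_max − τ), and sup_{T>0} C(T) < ∞ if either hypothesis (H1) or hypothesis (H2) holds. -/

import Mathlib

open Real MeasureTheory Filter Topology Set
open scoped ENNReal NNReal

noncomputable section

/-- Partial derivative of a space-time function in the first (space) variable. -/
def pdx (f : ℝ → ℝ → ℝ) : ℝ → ℝ → ℝ := fun x t => deriv (fun y => f y t) x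

/-- Partial derivative of a space-time function in the second (time) variable. -/
def pdt (f : ℝ → ℝ → ℝ) : ℝ → ℝ → ℝ := fun x t => deriv (fun s => f x s) t

/-- The time interval `[0, Tmax)` (with `Tmax ∈ (0,∞]`). -/
def It (Tmax : ℝ≥0∞) : Set ℝ := {t : ℝ | 0 ≤ t ∧ ENNReal.ofReal t < Tmax}

/-- The time interval `(0, Tmax)` (with `Tmax ∈ (0,∞]`). -/
def It' (Tmax : ℝ≥0∞) : Set ℝ := {t : ℝ | 0 < t ∧ ENNReal.ofReal t < Tmax}

/-- The waiting time `τ := min{1, Tmax/3}`, as a real number. -/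
def tauOf (Tmax : ℝ≥0∞) : ℝ := (min 1 (Tmax / 3)).toReal

/-- Hypothesis (B): `B` is nonnegative, bounded, and locally Hölder continuous on
`Ω̄ × [0,∞)` with some exponent `ϑ ∈ (0,1)`. -/
def HypB (a b : ℝ) (B : ℝ → ℝ → ℝ) : Prop :=
  (∀ x t : ℝ, 0 ≤ B x t) ∧ (∃ M : ℝ, ∀ x t : ℝ, B x t ≤ M) ∧
  ∃ ϑ : ℝ, ϑ ∈ Set.Ioo (0:ℝ) 1 ∧
    ∀ K : Set (ℝ × ℝ), IsCompact K → K ⊆ (Set.Icc a b) ×ˢ (Set.Ici (0:ℝ)) →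
      ∃ C : ℝ, ∀ p ∈ K, ∀ q ∈ K, |B p.1 p.2 - B q.1 q.2| ≤ C * dist p q ^ ϑ

/-- Hypothesis (init): `u0 ∈ C⁰(Ω̄)` nonnegative, `v0 ∈ W^{1,∞}(Ω)` (i.e. Lipschitz)
positive on `Ω̄`. -/
def HypInit (a b : ℝ) (u0 v0 : ℝ → ℝ) : Prop :=
  ContinuousOn u0 (Set.Icc a b) ∧ (∀ x ∈ Set.Icc a b, 0 ≤ u0 x) ∧
  (∃ L : ℝ≥0, LipschitzOnWith L v0 (Set.Icc a b)) ∧ (∀ x ∈ Set.Icc a b, 0 < v0 x)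

/-- Hypothesis (H1): `∫_0^∞ ∫_Ω B1 < ∞`. -/
def HypH1 (a b : ℝ) (B1 : ℝ → ℝ → ℝ) : Prop :=
  MeasureTheory.IntegrableOn (fun p : ℝ × ℝ => B1 p.1 p.2)
    ((Set.Ioo a b) ×ˢ (Set.Ioi (0:ℝ)))

/-- Hypothesis (H1'): `∫_t^{t+1} ∫_Ω B1 → 0` as `t → ∞`. -/
def HypH1' (a b : ℝ) (B1 : ℝ → ℝ → ℝ) : Prop :=
  Filter.Tendsto (fun t : ℝ => ∫ s in t..(t+1), ∫ x in Set.Ioo a b, B1 x s)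
    Filter.atTop (nhds 0)

/-- Hypothesis (H2): `inf_{t>0} ∫_Ω B2(·,t) > 0`. -/
def HypH2 (a b : ℝ) (B2 : ℝ → ℝ → ℝ) : Prop :=
  ∃ c : ℝ, 0 < c ∧ ∀ t : ℝ, 0 < t → c ≤ ∫ x in Set.Ioo a b, B2 x t

/-- Hypothesis (H3): `B2(·,t)` stabilizes to `B2inf ∈ L²(Ω)` in the averaged `L²` sense. -/
def HypH3 (a b : ℝ) (B2 : ℝ → ℝ → ℝ) (B2inf : ℝ → ℝ) : Prop :=
  MeasureTheory.MemLp B2inf 2 (MeasureTheory.volume.restrict (Set.Ioo a b)) ∧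
  Filter.Tendsto
    (fun t : ℝ => ∫ s in t..(t+1), ∫ x in Set.Ioo a b, (B2 x s - B2inf x)^2)
    Filter.atTop (nhds 0)

/-- A classical solution of the urban crime system
`u_t = u_xx − χ (u/v · v_x)_x − uv + B1`, `v_t = v_xx + uv − v + B2` on
`Ω̄ × [0, Tmax)`, `Ω = (a,b)`, with homogeneous Neumann boundary conditions and
initial data `(u0, v0)`; `u, v` are positive on `Ω̄ × (0, Tmax)`, belong to
`C⁰(Ω̄ × [0,Tmax)) ∩ C^{2,1}(Ω̄ × (0,Tmax))` and `v(·,t)` lies in `W^{1,r}(Ω)`,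
continuously in `t`, for every `r > 1`. -/
structure CrimeSol (a b χ : ℝ) (B1 B2 : ℝ → ℝ → ℝ) (u0 v0 : ℝ → ℝ)
    (u v : ℝ → ℝ → ℝ) (Tmax : ℝ≥0∞) : Prop where
  u_cont : ContinuousOn (fun p : ℝ × ℝ => u p.1 p.2) ((Set.Icc a b) ×ˢ It Tmax)
  v_cont : ContinuousOn (fun p : ℝ × ℝ => v p.1 p.2) ((Set.Icc a b) ×ˢ It Tmax)
  u_init : ∀ x ∈ Set.Icc a b, u x 0 = u0 x
  v_init : ∀ x ∈ Set.Icc a b, v x 0 = v0 x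
  u_pos : ∀ x ∈ Set.Icc a b, ∀ t ∈ It' Tmax, 0 < u x t
  v_pos : ∀ x ∈ Set.Icc a b, ∀ t ∈ It' Tmax, 0 < v x t
  u_reg : ∀ x ∈ Set.Icc a b, ∀ t ∈ It' Tmax,
    DifferentiableAt ℝ (fun y => u y t) x ∧
    DifferentiableAt ℝ (fun y => pdx u y t) x ∧
    DifferentiableAt ℝ (fun s => u x s) t
  v_reg : ∀ x ∈ Set.Icc a b, ∀ t ∈ It' Tmax,
    DifferentiableAt ℝ (fun y => v y t) x ∧
    DifferentiableAt ℝ (fun y => pdx v y t) x ∧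
    DifferentiableAt ℝ (fun s => v x s) t
  u_cont21 : ContinuousOn
    (fun p : ℝ × ℝ => (pdx u p.1 p.2, pdx (pdx u) p.1 p.2, pdt u p.1 p.2))
    ((Set.Icc a b) ×ˢ It' Tmax)
  v_cont21 : ContinuousOn
    (fun p : ℝ × ℝ => (pdx v p.1 p.2, pdx (pdx v) p.1 p.2, pdt v p.1 p.2))
    ((Set.Icc a b) ×ˢ It' Tmax)
  v_W1r : ∀ r : ℝ, 1 < r →
    (∀ t ∈ It Tmax,
      MeasureTheory.IntegrableOn (fun x => |pdx v x t| ^ r) (Set.Ioo a b)) ∧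
    ContinuousOn (fun t => ∫ x in Set.Ioo a b, |pdx v x t| ^ r) (It Tmax)
  u_eq : ∀ x ∈ Set.Ioo a b, ∀ t ∈ It' Tmax,
    pdt u x t = pdx (pdx u) x t
      - χ * pdx (fun y s => u y s / v y s * pdx v y s) x t
      - u x t * v x t + B1 x t
  v_eq : ∀ x ∈ Set.Ioo a b, ∀ t ∈ It' Tmax,
    pdt v x t = pdx (pdx v) x t + u x t * v x t - v x t + B2 x t
  u_bc : ∀ t ∈ It' Tmax, pdx u a t = 0 ∧ pdx u b t = 0
  v_bc : ∀ t ∈ It' Tmax, pdx v a t = 0 ∧ pdx v b t = 0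

/-- A classical solution of the stationary Neumann problem
`−w'' + w = B` in `Ω = (a,b)`, `w' = 0` on `∂Ω`. -/
def IsStationarySol (a b : ℝ) (B : ℝ → ℝ) (w : ℝ → ℝ) : Prop :=
  ContinuousOn w (Set.Icc a b) ∧
  (∀ x ∈ Set.Icc a b, DifferentiableAt ℝ w x ∧ DifferentiableAt ℝ (deriv w) x) ∧
  (∀ x ∈ Set.Ioo a b, -(deriv (deriv w) x) + w x = B x) ∧
  deriv w a = 0 ∧ deriv w b = 0

/-- The branches `q^±(p) = (1−p)/2 · (1 ∓/± √(1 − pχ²))`. -/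
def qminus (χ p : ℝ) : ℝ := (1 - p) / 2 * (1 - Real.sqrt (1 - p * χ^2))

def qplus (χ p : ℝ) : ℝ := (1 - p) / 2 * (1 + Real.sqrt (1 - p * χ^2))

/-- The auxiliary functions `φ₁, φ₂, φ₃` and the constant `p₀`. -/
def phi1 (p : ℝ) : ℝ := (p + 1) / (1 - p)

def phi2 (χ p : ℝ) : ℝ := (1 - p) / (2 * p) * (1 + Real.sqrt (1 - p * χ^2))

def phi3 (χ p : ℝ) : ℝ := (1 - p) / (2 * p) * (1 - Real.sqrt (1 - p * χ^2))

def p0 : ℝ := (2 * Real.sqrt 3 - 3) / 3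

lemma isOpen_It' (Tmax : ℝ≥0∞) : IsOpen (It' Tmax) := by
  have : It' Tmax = Set.Ioi 0 ∩ ENNReal.ofReal ⁻¹' (Set.Iio Tmax) := by
    ext t; simp [It']
  rw [this]
  exact isOpen_Ioi.inter (isOpen_Iio.preimage ENNReal.continuous_ofReal)

lemma It'_of_le {Tmax : ℝ≥0∞} {s t : ℝ} (hs : 0 < s) (hst : s ≤ t) (ht : t ∈ It' Tmax) :
    s ∈ It' Tmax :=
  ⟨hs, lt_of_le_of_lt (ENNReal.ofReal_le_ofReal hst) ht.2⟩

lemma exists_mem_It' {Tmax : ℝ≥0∞} (hT : 0 < Tmax) : ∃ δ, δ ∈ It' Tmax := by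
  obtain ⟨r, h0, hr⟩ := ENNReal.lt_iff_exists_nnreal_btwn.1 hT
  refine ⟨r, ?_, ?_⟩
  · exact_mod_cast h0
  · simpa using hr

/-- slices of jointly continuous functions -/
lemma slice_cont {a b : ℝ} {J : Set ℝ} {f : ℝ → ℝ → ℝ}
    (hf : ContinuousOn (fun p : ℝ × ℝ => f p.1 p.2) ((Set.Icc a b) ×ˢ J)) {t : ℝ} (ht : t ∈ J) :
    ContinuousOn (fun x => f x t) (Set.Icc a b) := by
  have h : ContinuousOn (fun x : ℝ => ((x, t) : ℝ × ℝ)) (Set.Icc a b) := by fun_prop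
  exact hf.comp h (fun x hx => ⟨hx, ht⟩)

lemma ii_of_cont {a b : ℝ} (hab : a ≤ b) {f : ℝ → ℝ} (hf : ContinuousOn f (Set.Icc a b)) :
    IntervalIntegrable f volume a b :=
  ContinuousOn.intervalIntegrable (by rwa [Set.uIcc_of_le hab])

/-- differentiation under the integral sign -/
lemma hasDerivAt_int {a b : ℝ} (hab : a ≤ b) {J : Set ℝ} (hJ : IsOpen J) {f f' : ℝ → ℝ → ℝ}
    (hder : ∀ x ∈ Set.Icc a b, ∀ t ∈ J, HasDerivAt (fun s => f x s) (f' x t) t)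
    (hc : ∀ t ∈ J, ContinuousOn (fun x => f x t) (Set.Icc a b))
    (hc' : ContinuousOn (fun p : ℝ × ℝ => f' p.1 p.2) ((Set.Icc a b) ×ˢ J))
    {t : ℝ} (ht : t ∈ J) :
    HasDerivAt (fun s => ∫ x in a..b, f x s) (∫ x in a..b, f' x t) t := by
  obtain ⟨ε, hε, hball⟩ := Metric.nhds_basis_closedBall.mem_iff.1 (hJ.mem_nhds ht)
  have hK : IsCompact ((Set.Icc a b) ×ˢ (Metric.closedBall t ε)) :=
    isCompact_Icc.prod (isCompact_closedBall t ε)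
  obtain ⟨M, hM⟩ := hK.exists_bound_of_continuousOn
    (hc'.mono (Set.prod_mono subset_rfl hball))
  have hsub : Set.uIoc a b ⊆ Set.Icc a b := by
    rw [Set.uIoc_of_le hab]; exact Set.Ioc_subset_Icc_self
  refine (intervalIntegral.hasDerivAt_integral_of_dominated_loc_of_deriv_le
    (F := fun s x => f x s) (F' := fun s x => f' x s) (bound := fun _ => M)
    (Metric.closedBall_mem_nhds t hε) ?_ ?_ ?_ ?_ ?_ ?_).2
  · filter_upwards [hJ.mem_nhds ht] with s hs
    exact (((hc s hs).mono hsub).aestronglyMeasurable measurableSet_uIoc)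
  · exact ii_of_cont hab (hc t ht)
  · exact (((slice_cont hc' ht).mono hsub).aestronglyMeasurable measurableSet_uIoc)
  · refine Filter.Eventually.of_forall fun x hx s hs => hM (x, s) ⟨hsub hx, hs⟩
  · exact intervalIntegrable_const
  · exact Filter.Eventually.of_forall fun x hx s hs => hder x (hsub hx) s (hball hs)

/-- linear differential inequality -/
lemma ode_bound {Tmax : ℝ≥0∞} {g g' : ℝ → ℝ} (hg : ∀ t ∈ It' Tmax, HasDerivAt g (g' t) t)
    {k K L δ : ℝ} (hKL : K ≤ k * L)
    (hineq : ∀ t ∈ It' Tmax, g' t ≤ K - k * g t) (hδ : 0 < δ)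
    (hL : ∀ t ∈ It' Tmax, t ≤ δ → g t ≤ L) : ∀ t ∈ It' Tmax, g t ≤ L := by
  intro t ht
  rcases le_total t δ with h | h
  · exact hL t ht h
  have hmem : ∀ s ∈ Set.Icc δ t, s ∈ It' Tmax := fun s hs =>
    It'_of_le (lt_of_lt_of_le hδ hs.1) hs.2 ht
  have hd : ∀ s ∈ Set.Icc δ t, HasDerivAt (fun s => Real.exp (k * s) * (g s - L))
      (Real.exp (k * s) * k * (g s - L) + Real.exp (k * s) * g' s) s := by
    intro s hs
    have h1 : HasDerivAt (fun s : ℝ => Real.exp (k * s)) (Real.exp (k * s) * k) s := by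
      simpa using ((hasDerivAt_id s).const_mul k).exp
    exact h1.mul ((hg s (hmem s hs)).sub_const L)
  have hanti : AntitoneOn (fun s => Real.exp (k * s) * (g s - L)) (Set.Icc δ t) := by
    refine antitoneOn_of_deriv_nonpos (convex_Icc δ t)
      (fun s hs => (hd s hs).continuousAt.continuousWithinAt)
      (fun s hs => (hd s (interior_subset hs)).differentiableAt.differentiableWithinAt) ?_
    intro s hs
    rw [(hd s (interior_subset hs)).deriv]
    have h1 := hineq s (hmem s (interior_subset hs))
    have h2 := (Real.exp_pos (k * s)).le
    have h3 : k * (g s - L) + g' s ≤ 0 := by nlinarith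
    calc _ = Real.exp (k * s) * (k * (g s - L) + g' s) := by ring
      _ ≤ 0 := mul_nonpos_of_nonneg_of_nonpos h2 h3
  have h1 := hanti (Set.left_mem_Icc.2 h) (Set.right_mem_Icc.2 h) h
  have h2 := hL δ (hmem δ (Set.left_mem_Icc.2 h)) le_rfl
  simp only at h1
  have h3 : Real.exp (k * δ) * (g δ - L) ≤ 0 :=
    mul_nonpos_of_nonneg_of_nonpos (Real.exp_pos _).le (by linarith)
  have h4 : Real.exp (k * t) * (g t - L) ≤ 0 := h1.trans h3
  by_contra hcon
  push Not at hcon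
  have := mul_pos (Real.exp_pos (k * t)) (sub_pos.2 hcon)
  linarith

lemma HypB.cont {a b : ℝ} {B : ℝ → ℝ → ℝ} (hB : HypB a b B) :
    ContinuousOn (fun p : ℝ × ℝ => B p.1 p.2) ((Set.Icc a b) ×ˢ (Set.Ici (0:ℝ))) := by
  obtain ⟨-, -, ϑ, hϑ, hH⟩ := hB
  intro p hp
  obtain ⟨C, hC⟩ := hH ((Set.Icc a b) ×ˢ (Set.Icc 0 (p.2 + 1)))
    (isCompact_Icc.prod isCompact_Icc) (Set.prod_mono subset_rfl Set.Icc_subset_Ici_self)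
  have hpK : p ∈ (Set.Icc a b) ×ˢ (Set.Icc 0 (p.2 + 1)) := ⟨hp.1, hp.2, by linarith⟩
  have hev : ∀ᶠ z : ℝ × ℝ in 𝓝[(Set.Icc a b) ×ˢ (Set.Ici (0:ℝ))] p,
      z ∈ (Set.Icc a b) ×ˢ (Set.Icc 0 (p.2 + 1)) := by
    have h1 : ∀ᶠ z : ℝ × ℝ in 𝓝 p, z.2 < p.2 + 1 :=
      continuous_snd.continuousAt.eventually_lt continuousAt_const (by simp)
    filter_upwards [self_mem_nhdsWithin, nhdsWithin_le_nhds h1] with z hz hz1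
    exact ⟨hz.1, hz.2, hz1.le⟩
  refine tendsto_iff_dist_tendsto_zero.2 ?_
  have hlim : Tendsto (fun z : ℝ × ℝ => C * dist z p ^ ϑ)
      (𝓝[(Set.Icc a b) ×ˢ (Set.Ici (0:ℝ))] p) (𝓝 0) := by
    have h0 : ContinuousAt (fun z : ℝ × ℝ => C * dist z p ^ ϑ) p := by
      have : ContinuousAt (fun z : ℝ × ℝ => dist z p) p := by fun_prop
      exact continuousAt_const.mul (this.rpow_const (Or.inr hϑ.1.le))
    have h2 := h0.tendsto.mono_left (nhdsWithin_le_nhds (s := (Set.Icc a b) ×ˢ (Set.Ici (0:ℝ))))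
    simpa [Real.zero_rpow hϑ.1.ne'] using h2
  refine squeeze_zero' (Filter.Eventually.of_forall fun _ => dist_nonneg) ?_ hlim
  filter_upwards [hev] with z hz
  exact hC z hz p hpK

lemma ioo_eq {a b : ℝ} (hab : a ≤ b) (f : ℝ → ℝ) :
    ∫ x in Set.Ioo a b, f x = ∫ x in a..b, f x := by
  rw [intervalIntegral.integral_of_le hab, integral_Ioc_eq_integral_Ioo]

lemma int_mono {a b : ℝ} (hab : a ≤ b) {f g : ℝ → ℝ} (hf : ContinuousOn f (Set.Icc a b))
    (hg : ContinuousOn g (Set.Icc a b)) (h : ∀ x ∈ Set.Icc a b, f x ≤ g x) :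
    ∫ x in a..b, f x ≤ ∫ x in a..b, g x :=
  intervalIntegral.integral_mono_on hab (ii_of_cont hab hf) (ii_of_cont hab hg) h

lemma int_congr_Ioo {a b : ℝ} (hab : a ≤ b) {f g : ℝ → ℝ} (h : ∀ x ∈ Set.Ioo a b, f x = g x) :
    ∫ x in a..b, f x = ∫ x in a..b, g x := by
  rw [← ioo_eq hab, ← ioo_eq hab]
  exact setIntegral_congr_fun measurableSet_Ioo h

/-- integration by parts with weight -/
lemma ibp {a b : ℝ} (hab : a ≤ b) {V V1 V2 : ℝ → ℝ} (p : ℝ)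
    (h1 : ∀ x ∈ Set.Icc a b, HasDerivAt V (V1 x) x)
    (h2 : ∀ x ∈ Set.Icc a b, HasDerivAt V1 (V2 x) x)
    (hc : ContinuousOn V2 (Set.Icc a b)) (hpos : ∀ x ∈ Set.Icc a b, 0 < V x)
    (ha : V1 a = 0) (hb : V1 b = 0) :
    ∫ x in a..b, V x ^ p * V2 x = -p * ∫ x in a..b, V x ^ (p - 1) * V1 x ^ 2 := by
  have cV : ContinuousOn V (Set.Icc a b) := fun x hx => (h1 x hx).continuousAt.continuousWithinAt
  have cV1 : ContinuousOn V1 (Set.Icc a b) := fun x hx => (h2 x hx).continuousAt.continuousWithinAt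
  have cp : ∀ r : ℝ, ContinuousOn (fun x => V x ^ r) (Set.Icc a b) := fun r =>
    cV.rpow_const fun x hx => Or.inl (hpos x hx).ne'
  have i1 : IntervalIntegrable (fun x => V x ^ p * V2 x) volume a b :=
    ii_of_cont hab ((cp p).mul hc)
  have i2 : IntervalIntegrable (fun x => p * (V x ^ (p - 1) * V1 x ^ 2)) volume a b :=
    ii_of_cont hab (((cp (p-1)).mul (cV1.pow 2)).const_smul p)
  have hd : ∀ x ∈ Set.uIcc a b, HasDerivAt (fun x => V x ^ p * V1 x)
      (p * (V x ^ (p - 1) * V1 x ^ 2) + V x ^ p * V2 x) x := by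
    intro x hx
    rw [Set.uIcc_of_le hab] at hx
    have := ((h1 x hx).rpow_const (p := p) (Or.inl (hpos x hx).ne')).mul (h2 x hx)
    refine this.congr_deriv ?_
    ring
  have := intervalIntegral.integral_eq_sub_of_hasDerivAt hd (i2.add i1)
  rw [intervalIntegral.integral_add i2 i1, intervalIntegral.integral_const_mul, ha, hb] at this
  linarith

/-- oscillation estimate for the logarithm -/
lemma log_osc {a b : ℝ} (hab : a < b) {V V1 : ℝ → ℝ}
    (h1 : ∀ x ∈ Set.Icc a b, HasDerivAt V (V1 x) x)
    (hc : ContinuousOn V1 (Set.Icc a b)) (hpos : ∀ x ∈ Set.Icc a b, 0 < V x) :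
    ∀ x ∈ Set.Icc a b, Real.log (V x) ≤ (∫ y in a..b, Real.log (V y)) / (b - a)
      + ∫ y in a..b, |V1 y / V y| := by
  intro x hx
  have cV : ContinuousOn V (Set.Icc a b) := fun x hx => (h1 x hx).continuousAt.continuousWithinAt
  have cq : ContinuousOn (fun y => V1 y / V y) (Set.Icc a b) :=
    hc.div cV fun x hx => (hpos x hx).ne'
  have cl : ContinuousOn (fun y => Real.log (V y)) (Set.Icc a b) :=
    cV.log fun x hx => (hpos x hx).ne'
  set D := ∫ y in a..b, |V1 y / V y| with hD
  have key : ∀ y ∈ Set.Icc a b, Real.log (V x) - D ≤ Real.log (V y) := by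
    intro y hy
    have hsub : Set.uIcc y x ⊆ Set.Icc a b := Set.uIcc_subset_Icc hy hx
    have e : ∫ s in y..x, V1 s / V s = Real.log (V x) - Real.log (V y) := by
      refine intervalIntegral.integral_eq_sub_of_hasDerivAt
        (f := fun s => Real.log (V s)) ?_ ?_
      · intro s hs
        exact (h1 s (hsub hs)).log (hpos s (hsub hs)).ne'
      · exact (cq.mono hsub).intervalIntegrable
    have h3 : abs (∫ s in y..x, V1 s / V s) ≤ abs (∫ s in y..x, |V1 s / V s|) :=
      intervalIntegral.norm_integral_le_abs_integral_norm (f := fun s => V1 s / V s)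
    have h4 : abs (∫ s in y..x, |V1 s / V s|) ≤ abs (∫ s in a..b, |V1 s / V s|) := by
      refine intervalIntegral.abs_integral_mono_interval ?_ ?_ ?_
      · rw [Set.uIoc_of_le hab.le]
        intro z hz
        rcases le_total y x with h | h
        · rw [Set.uIoc_of_le h] at hz; exact ⟨lt_of_le_of_lt hy.1 hz.1, hz.2.trans hx.2⟩
        · rw [Set.uIoc_of_ge h] at hz; exact ⟨lt_of_le_of_lt hx.1 hz.1, hz.2.trans hy.2⟩
      · exact Filter.Eventually.of_forall fun s => abs_nonneg (V1 s / V s)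
      · exact ii_of_cont hab.le cq.abs
    have h5 : 0 ≤ D := intervalIntegral.integral_nonneg hab.le fun s _ => abs_nonneg _
    rw [← hD, abs_of_nonneg h5] at h4
    have h6 := le_abs_self (∫ s in y..x, V1 s / V s)
    linarith
  have h7 := int_mono hab.le (continuousOn_const (c := Real.log (V x) - D)) cl key
  rw [intervalIntegral.integral_const, smul_eq_mul] at h7
  have hba : 0 < b - a := sub_pos.2 hab
  have : Real.log (V x) - D ≤ (∫ y in a..b, Real.log (V y)) / (b - a) := by
    rw [le_div_iff₀ hba]; linarith
  linarith

section sol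

variable {a b χ : ℝ} {B1 B2 : ℝ → ℝ → ℝ} {u0 v0 : ℝ → ℝ} {Tmax : ℝ≥0∞} {u v : ℝ → ℝ → ℝ}

lemma It'_subset_It : It' Tmax ⊆ It Tmax := fun _ h => ⟨h.1.le, h.2⟩

lemma CrimeSol.cu (h : CrimeSol a b χ B1 B2 u0 v0 u v Tmax) :
    ContinuousOn (fun p : ℝ × ℝ => u p.1 p.2) ((Set.Icc a b) ×ˢ It' Tmax) :=
  h.u_cont.mono (Set.prod_mono subset_rfl It'_subset_It)

lemma CrimeSol.cv (h : CrimeSol a b χ B1 B2 u0 v0 u v Tmax) :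
    ContinuousOn (fun p : ℝ × ℝ => v p.1 p.2) ((Set.Icc a b) ×ˢ It' Tmax) :=
  h.v_cont.mono (Set.prod_mono subset_rfl It'_subset_It)

lemma CrimeSol.cvp (h : CrimeSol a b χ B1 B2 u0 v0 u v Tmax) (r : ℝ) :
    ContinuousOn (fun p : ℝ × ℝ => v p.1 p.2 ^ r) ((Set.Icc a b) ×ˢ It' Tmax) :=
  h.cv.rpow_const fun p hp => Or.inl (h.v_pos p.1 hp.1 p.2 hp.2).ne'

lemma CrimeSol.cBslice {B : ℝ → ℝ → ℝ} (hB : HypB a b B) {t : ℝ} (ht : t ∈ It' Tmax) :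
    ContinuousOn (fun x => B x t) (Set.Icc a b) := slice_cont hB.cont (Set.mem_Ici.2 ht.1.le)

lemma CrimeSol.v_test (h : CrimeSol a b χ B1 B2 u0 v0 u v Tmax) (hab : a < b)
    (hB2 : HypB a b B2) (p : ℝ) {t : ℝ} (ht : t ∈ It' Tmax) :
    ∫ x in a..b, v x t ^ p * pdt v x t =
      -p * (∫ x in a..b, v x t ^ (p - 1) * pdx v x t ^ 2)
      + (∫ x in a..b, v x t ^ (p + 1) * u x t) - (∫ x in a..b, v x t ^ (p + 1))
      + ∫ x in a..b, v x t ^ p * B2 x t := by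
  have cxx : ContinuousOn (fun x => pdx (pdx v) x t) (Set.Icc a b) :=
    slice_cont (f := pdx (pdx v)) h.v_cont21.snd.fst ht
  have cpow : ∀ r : ℝ, ContinuousOn (fun x => v x t ^ r) (Set.Icc a b) := fun r =>
    slice_cont (f := fun x t => v x t ^ r) (h.cvp r) ht
  have cu : ContinuousOn (fun x => u x t) (Set.Icc a b) := slice_cont h.cu ht
  have cB : ContinuousOn (fun x => B2 x t) (Set.Icc a b) := CrimeSol.cBslice hB2 ht
  have hibp := ibp hab.le (V := fun x => v x t) (V1 := fun x => pdx v x t)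
    (V2 := fun x => pdx (pdx v) x t) p
    (fun x hx => (h.v_reg x hx t ht).1.hasDerivAt)
    (fun x hx => (h.v_reg x hx t ht).2.1.hasDerivAt) cxx (fun x hx => h.v_pos x hx t ht)
    (h.v_bc t ht).1 (h.v_bc t ht).2
  have i1 : IntervalIntegrable (fun x => v x t ^ p * pdx (pdx v) x t) volume a b :=
    ii_of_cont hab.le ((cpow p).mul cxx)
  have i2 : IntervalIntegrable (fun x => v x t ^ (p + 1) * u x t) volume a b :=
    ii_of_cont hab.le ((cpow (p+1)).mul cu)
  have i3 : IntervalIntegrable (fun x => v x t ^ (p + 1)) volume a b :=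
    ii_of_cont hab.le (cpow (p+1))
  have i4 : IntervalIntegrable (fun x => v x t ^ p * B2 x t) volume a b :=
    ii_of_cont hab.le ((cpow p).mul cB)
  have e : ∫ x in a..b, v x t ^ p * pdt v x t = ∫ x in a..b,
      (v x t ^ p * pdx (pdx v) x t + v x t ^ (p + 1) * u x t - v x t ^ (p + 1)
        + v x t ^ p * B2 x t) := by
    refine int_congr_Ioo hab.le fun x hx => ?_
    rw [h.v_eq x hx t ht,
      Real.rpow_add_one (h.v_pos x (Set.Ioo_subset_Icc_self hx) t ht).ne']
    ring
  rw [e, intervalIntegral.integral_add ((i1.add i2).sub i3) i4,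
    intervalIntegral.integral_sub (i1.add i2) i3, intervalIntegral.integral_add i1 i2, hibp]

lemma CrimeSol.dU (h : CrimeSol a b χ B1 B2 u0 v0 u v Tmax) (hab : a < b)
    (hB1 : HypB a b B1) {t : ℝ} (ht : t ∈ It' Tmax) :
    HasDerivAt (fun s => ∫ x in a..b, u x s)
      (-(∫ x in a..b, u x t * v x t) + ∫ x in a..b, B1 x t) t := by
  have h0 := hasDerivAt_int hab.le (isOpen_It' Tmax) (f := u) (f' := pdt u)
    (fun x hx t ht => (h.u_reg x hx t ht).2.2.hasDerivAt)
    (fun t ht => slice_cont h.cu ht) h.u_cont21.snd.snd ht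
  refine h0.congr_deriv ?_
  have cu : ContinuousOn (fun x => u x t) (Set.Icc a b) := slice_cont h.cu ht
  have cv : ContinuousOn (fun x => v x t) (Set.Icc a b) := slice_cont h.cv ht
  have cB : ContinuousOn (fun x => B1 x t) (Set.Icc a b) := CrimeSol.cBslice hB1 ht
  have cux : ContinuousOn (fun x => pdx u x t) (Set.Icc a b) :=
    slice_cont (f := pdx u) h.u_cont21.fst ht
  have cuxx : ContinuousOn (fun x => pdx (pdx u) x t) (Set.Icc a b) :=
    slice_cont (f := pdx (pdx u)) h.u_cont21.snd.fst ht
  have cvx : ContinuousOn (fun x => pdx v x t) (Set.Icc a b) :=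
    slice_cont (f := pdx v) h.v_cont21.fst ht
  have cvxx : ContinuousOn (fun x => pdx (pdx v) x t) (Set.Icc a b) :=
    slice_cont (f := pdx (pdx v)) h.v_cont21.snd.fst ht
  have hne : ∀ x ∈ Set.Icc a b, v x t ≠ 0 := fun x hx => (h.v_pos x hx t ht).ne'
  have hdq : ∀ x ∈ Set.Icc a b, HasDerivAt (fun y => u y t / v y t * pdx v y t)
      ((pdx u x t * v x t - u x t * pdx v x t) / v x t ^ 2 * pdx v x t
        + u x t / v x t * pdx (pdx v) x t) x := by
    intro x hx
    exact (((h.u_reg x hx t ht).1.hasDerivAt.div (h.v_reg x hx t ht).1.hasDerivAt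
      (hne x hx))).mul (h.v_reg x hx t ht).2.1.hasDerivAt
  set Q : ℝ → ℝ := fun x => (pdx u x t * v x t - u x t * pdx v x t) / v x t ^ 2 * pdx v x t
        + u x t / v x t * pdx (pdx v) x t with hQ
  have cQ : ContinuousOn Q (Set.Icc a b) := by
    refine ((((cux.mul cv).sub (cu.mul cvx)).div (cv.pow 2) ?_).mul cvx).add
      ((cu.div cv hne).mul cvxx)
    intro x hx
    exact pow_ne_zero 2 (hne x hx)
  have iflux : IntervalIntegrable (fun x => pdx (pdx u) x t - χ * Q x) volume a b :=
    ii_of_cont hab.le (cuxx.sub (cQ.const_smul χ))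
  have hflux : ∫ x in a..b, (pdx (pdx u) x t - χ * Q x) = 0 := by
    have := intervalIntegral.integral_eq_sub_of_hasDerivAt
      (f := fun x => pdx u x t - χ * (u x t / v x t * pdx v x t))
      (f' := fun x => pdx (pdx u) x t - χ * Q x) (a := a) (b := b) ?_ iflux
    · rw [this, (h.u_bc t ht).1, (h.u_bc t ht).2, (h.v_bc t ht).1, (h.v_bc t ht).2]; ring
    · intro x hx
      rw [Set.uIcc_of_le hab.le] at hx
      exact (h.u_reg x hx t ht).2.1.hasDerivAt.sub ((hdq x hx).const_mul χ)
  have i2 : IntervalIntegrable (fun x => u x t * v x t) volume a b :=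
    ii_of_cont hab.le (cu.mul cv)
  have i3 : IntervalIntegrable (fun x => B1 x t) volume a b := ii_of_cont hab.le cB
  have e : ∫ x in a..b, pdt u x t = ∫ x in a..b,
      ((pdx (pdx u) x t - χ * Q x) - u x t * v x t + B1 x t) := by
    refine int_congr_Ioo hab.le fun x hx => ?_
    rw [h.u_eq x hx t ht]
    have : pdx (fun y s => u y s / v y s * pdx v y s) x t = Q x :=
      (hdq x (Set.Ioo_subset_Icc_self hx)).deriv
    rw [this]
  rw [e, intervalIntegral.integral_add (iflux.sub i2) i3,
    intervalIntegral.integral_sub iflux i2, hflux]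
  ring

lemma CrimeSol.dV (h : CrimeSol a b χ B1 B2 u0 v0 u v Tmax) (hab : a < b)
    (hB2 : HypB a b B2) {t : ℝ} (ht : t ∈ It' Tmax) :
    HasDerivAt (fun s => ∫ x in a..b, v x s)
      ((∫ x in a..b, u x t * v x t) - (∫ x in a..b, v x t) + ∫ x in a..b, B2 x t) t := by
  have h0 := hasDerivAt_int hab.le (isOpen_It' Tmax) (f := v) (f' := pdt v)
    (fun x hx t ht => (h.v_reg x hx t ht).2.2.hasDerivAt)
    (fun t ht => slice_cont h.cv ht) h.v_cont21.snd.snd ht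
  refine h0.congr_deriv ?_
  have := h.v_test hab hB2 0 ht
  simp only [Real.rpow_zero, one_mul, neg_zero, zero_mul, zero_add, Real.rpow_one] at this
  rw [this]
  simp only [mul_comm]

lemma CrimeSol.dZ (h : CrimeSol a b χ B1 B2 u0 v0 u v Tmax) (hab : a < b)
    (hB2 : HypB a b B2) {t : ℝ} (ht : t ∈ It' Tmax) :
    HasDerivAt (fun s => ∫ x in a..b, Real.log (v x s))
      ((∫ x in a..b, v x t ^ (-2 : ℝ) * pdx v x t ^ 2) + (∫ x in a..b, u x t) - (b - a)
        + ∫ x in a..b, v x t ^ (-1 : ℝ) * B2 x t) t := by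
  have h0 := hasDerivAt_int hab.le (isOpen_It' Tmax) (f := fun x s => Real.log (v x s))
    (f' := fun x s => v x s ^ (-1 : ℝ) * pdt v x s) ?_ ?_
    ((h.cvp (-1)).mul h.v_cont21.snd.snd) ht
  · refine h0.congr_deriv ?_
    rw [h.v_test hab hB2 (-1) ht]
    norm_num
  · intro x hx t ht
    have hd : HasDerivAt (fun s => v x s) (pdt v x t) t := (h.v_reg x hx t ht).2.2.hasDerivAt
    refine (hd.log (h.v_pos x hx t ht).ne').congr_deriv ?_
    rw [Real.rpow_neg_one]; ring
  · intro t ht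
    exact (slice_cont h.cv ht).log fun x hx => (h.v_pos x hx t ht).ne'

lemma CrimeSol.dP (h : CrimeSol a b χ B1 B2 u0 v0 u v Tmax) (hab : a < b)
    (hB2 : HypB a b B2) (q : ℝ) {t : ℝ} (ht : t ∈ It' Tmax) :
    HasDerivAt (fun s => ∫ x in a..b, v x s ^ q)
      (q * ((1 - q) * (∫ x in a..b, v x t ^ (q - 2) * pdx v x t ^ 2)
        + (∫ x in a..b, v x t ^ q * u x t) - (∫ x in a..b, v x t ^ q)
        + ∫ x in a..b, v x t ^ (q - 1) * B2 x t)) t := by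
  have h0 := hasDerivAt_int hab.le (isOpen_It' Tmax) (f := fun x s => v x s ^ q)
    (f' := fun x s => q * (v x s ^ (q - 1) * pdt v x s)) ?_ ?_
    (((h.cvp (q - 1)).mul h.v_cont21.snd.snd).const_smul q) ht
  · refine h0.congr_deriv ?_
    rw [intervalIntegral.integral_const_mul, h.v_test hab hB2 (q - 1) ht]
    have e1 : q - 1 + 1 = q := by ring
    have e2 : q - 1 - 1 = q - 2 := by ring
    rw [e1, e2]
    ring
  · intro x hx t ht
    have hd : HasDerivAt (fun s => v x s) (pdt v x t) t := (h.v_reg x hx t ht).2.2.hasDerivAt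
    refine (hd.rpow_const (p := q) (Or.inl (h.v_pos x hx t ht).ne')).congr_deriv ?_
    ring
  · intro t ht
    exact slice_cont (f := fun x s => v x s ^ q) (h.cvp q) ht

lemma CrimeSol.near_zero (h : CrimeSol a b χ B1 B2 u0 v0 u v Tmax)
    (hinit : HypInit a b u0 v0) (hT : 0 < Tmax) (hab : a < b) :
    ∃ δ K k : ℝ, 0 < δ ∧ 0 < k ∧ ∀ t ∈ It' Tmax, t ≤ δ → ∀ x ∈ Set.Icc a b,
      u x t ≤ K ∧ v x t ≤ K ∧ k ≤ v x t := by
  obtain ⟨δ, hδ⟩ := exists_mem_It' hT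
  have hK : IsCompact ((Set.Icc a b) ×ˢ (Set.Icc 0 δ)) := isCompact_Icc.prod isCompact_Icc
  have hsub : (Set.Icc a b) ×ˢ (Set.Icc 0 δ) ⊆ (Set.Icc a b) ×ˢ It Tmax :=
    Set.prod_mono subset_rfl fun s hs =>
      ⟨hs.1, lt_of_le_of_lt (ENNReal.ofReal_le_ofReal hs.2) hδ.2⟩
  obtain ⟨K1, hK1⟩ := hK.exists_bound_of_continuousOn (h.u_cont.mono hsub)
  obtain ⟨K2, hK2⟩ := hK.exists_bound_of_continuousOn (h.v_cont.mono hsub)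
  obtain ⟨p, hp, hmin⟩ := hK.exists_isMinOn
    ⟨(a, 0), ⟨Set.left_mem_Icc.2 hab.le, Set.left_mem_Icc.2 hδ.1.le⟩⟩ (h.v_cont.mono hsub)
  refine ⟨δ, max K1 K2, v p.1 p.2, hδ.1, ?_, ?_⟩
  · rcases eq_or_lt_of_le hp.2.1 with h0 | h0
    · rw [← h0, h.v_init p.1 hp.1]; exact hinit.2.2.2 p.1 hp.1
    · exact h.v_pos p.1 hp.1 p.2 (It'_of_le h0 hp.2.2 hδ)
  · intro t ht htδ x hx
    have hm : (x, t) ∈ (Set.Icc a b) ×ˢ (Set.Icc 0 δ) := ⟨hx, ht.1.le, htδ⟩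
    exact ⟨((le_abs_self _).trans (hK1 _ hm)).trans (le_max_left _ _),
      ((le_abs_self _).trans (hK2 _ hm)).trans (le_max_right _ _), hmin hm⟩

lemma int_le_const {f : ℝ → ℝ} {K : ℝ} (hab : a < b) (hf : ContinuousOn f (Set.Icc a b))
    (h : ∀ x ∈ Set.Icc a b, f x ≤ K) : ∫ x in a..b, f x ≤ K * (b - a) := by
  have := int_mono hab.le hf continuousOn_const h
  rwa [intervalIntegral.integral_const, smul_eq_mul, mul_comm] at this

lemma const_le_int {f : ℝ → ℝ} {K : ℝ} (hab : a < b) (hf : ContinuousOn f (Set.Icc a b))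
    (h : ∀ x ∈ Set.Icc a b, K ≤ f x) : K * (b - a) ≤ ∫ x in a..b, f x := by
  have := int_mono hab.le continuousOn_const hf h
  rwa [intervalIntegral.integral_const, smul_eq_mul, mul_comm] at this

lemma HypB.exists_bound {B : ℝ → ℝ → ℝ} (hB : HypB a b B) (hab : a < b) :
    ∃ M, 0 ≤ M ∧ ∀ t ∈ It' Tmax, ∫ x in a..b, B x t ≤ M := by
  obtain ⟨M, hM⟩ := hB.2.1
  have hM0 : 0 ≤ M := (hB.1 0 0).trans (hM 0 0)
  refine ⟨M * (b - a), mul_nonneg hM0 (sub_pos.2 hab).le, fun t ht => ?_⟩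
  exact int_le_const hab (CrimeSol.cBslice hB ht) fun x _ => hM x t

lemma CrimeSol.intu_nonneg (h : CrimeSol a b χ B1 B2 u0 v0 u v Tmax) (hab : a < b) {t : ℝ}
    (ht : t ∈ It' Tmax) : 0 ≤ ∫ x in a..b, u x t :=
  intervalIntegral.integral_nonneg hab.le fun x hx => (h.u_pos x hx t ht).le

lemma CrimeSol.intv_nonneg (h : CrimeSol a b χ B1 B2 u0 v0 u v Tmax) (hab : a < b) {t : ℝ}
    (ht : t ∈ It' Tmax) : 0 ≤ ∫ x in a..b, v x t :=
  intervalIntegral.integral_nonneg hab.le fun x hx => (h.v_pos x hx t ht).le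

lemma CrimeSol.core (h : CrimeSol a b χ B1 B2 u0 v0 u v Tmax) (hab : a < b)
    (hB2 : HypB a b B2) {q : ℝ} (hq : q ∈ Set.Ioo (0:ℝ) 1) {Y t τ : ℝ} (ht : 0 < t)
    (hτ : 0 ≤ τ) (hτ1 : τ ≤ 1) (htτ : t + τ ∈ It' Tmax) (hY0 : 0 ≤ Y)
    (hY : ∀ s ∈ Set.Icc t (t + τ), ∫ x in a..b, v x s ≤ Y) :
    (∫ s in t..(t + τ), ∫ x in Set.Ioo a b, v x s ^ (q - 2) * (pdx v x s) ^ 2)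
      ≤ 2 * ((b - a) + Y) / (q * (1 - q)) := by
  obtain ⟨hq0, hq1⟩ := hq
  have hqq : 0 < q * (1 - q) := mul_pos hq0 (by linarith)
  have hba : 0 < b - a := sub_pos.2 hab
  set R := (b - a) + Y with hR
  have hR0 : 0 ≤ R := by linarith
  set E : ℝ → ℝ := fun s => ∫ x in Set.Ioo a b, v x s ^ (q - 2) * (pdx v x s) ^ 2 with hE
  by_cases hint : IntervalIntegrable E volume t (t + τ)
  swap
  · rw [intervalIntegral.integral_undef hint]
    positivity
  have hle : t ≤ t + τ := by linarith
  have hmem : ∀ s ∈ Set.Icc t (t + τ), s ∈ It' Tmax := fun s hs =>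
    It'_of_le (lt_of_lt_of_le ht hs.1) hs.2 htτ
  have hΦ0 : ∀ s ∈ Set.Icc t (t + τ), 0 ≤ ∫ x in a..b, v x s ^ q := fun s hs =>
    intervalIntegral.integral_nonneg hab.le fun x hx =>
      Real.rpow_nonneg (h.v_pos x hx s (hmem s hs)).le q
  have hΦ : ∀ s ∈ Set.Icc t (t + τ), ∫ x in a..b, v x s ^ q ≤ R := by
    intro s hs
    have hsJ := hmem s hs
    have cv : ContinuousOn (fun x => v x s) (Set.Icc a b) := slice_cont h.cv hsJ
    have h1 : ∫ x in a..b, v x s ^ q ≤ ∫ x in a..b, (1 + v x s) := by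
      refine int_mono hab.le (slice_cont (f := fun x s => v x s ^ q) (h.cvp q) hsJ)
        (continuousOn_const.add cv) fun x hx => ?_
      have hv := h.v_pos x hx s hsJ
      rcases le_total (v x s) 1 with h1 | h1
      · have := Real.rpow_le_one hv.le h1 hq0.le
        linarith
      · have := Real.rpow_le_rpow_of_exponent_le h1 hq1.le
        rw [Real.rpow_one] at this
        linarith
    rw [intervalIntegral.integral_add intervalIntegrable_const (ii_of_cont hab.le cv),
      intervalIntegral.integral_const, smul_eq_mul, mul_one] at h1
    have := hY s hs
    linarith
  have hfin := intervalIntegral.integral_le_sub_of_hasDeriv_right_of_le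
    (g := fun s => ∫ x in a..b, v x s ^ q) (φ := fun s => q * (1 - q) * E s - q * R) hle
    (fun s hs => (h.dP hab hB2 q (hmem s hs)).continuousAt.continuousWithinAt)
    (fun s hs => (h.dP hab hB2 q (hmem s (Set.Ioo_subset_Icc_self hs))).hasDerivWithinAt)
    ?_ ?_
  · rw [intervalIntegral.integral_sub (hint.const_mul _) intervalIntegrable_const,
      intervalIntegral.integral_const_mul, intervalIntegral.integral_const, smul_eq_mul] at hfin
    have h1 := hΦ _ (Set.right_mem_Icc.2 hle)
    have h2 := hΦ0 _ (Set.left_mem_Icc.2 hle)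
    rw [le_div_iff₀ hqq]
    have h3 : (t + τ - t) * (q * R) ≤ R := by
      have : (t + τ - t) * (q * R) = (τ * q) * R := by ring
      rw [this]
      have h4 : τ * q ≤ 1 := mul_le_one₀ hτ1 hq0.le hq1.le
      nlinarith
    nlinarith
  · have h1 : IntegrableOn E (Set.Icc t (t + τ)) := by
      rw [integrableOn_Icc_iff_integrableOn_Ioc]
      exact (intervalIntegrable_iff_integrableOn_Ioc_of_le hle).1 hint
    exact (h1.const_mul _).sub (integrableOn_const (by simp))
  · intro s hs
    have hs' := Set.Ioo_subset_Icc_self hs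
    have hsJ := hmem s hs'
    have h1 := hΦ s hs'
    have h2 : 0 ≤ ∫ x in a..b, v x s ^ q * u x s :=
      intervalIntegral.integral_nonneg hab.le fun x hx =>
        mul_nonneg (Real.rpow_nonneg (h.v_pos x hx s hsJ).le q) (h.u_pos x hx s hsJ).le
    have h3 : 0 ≤ ∫ x in a..b, v x s ^ (q - 1) * B2 x s :=
      intervalIntegral.integral_nonneg hab.le fun x hx =>
        mul_nonneg (Real.rpow_nonneg (h.v_pos x hx s hsJ).le _) (hB2.1 x s)
    have h4 : E s = ∫ x in a..b, v x s ^ (q - 2) * (pdx v x s) ^ 2 := ioo_eq hab.le _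
    rw [← h4]
    have : q * (1 - q) * E s - q * R = q * ((1 - q) * E s + 0 - R + 0) := by ring
    rw [this]
    refine mul_le_mul_of_nonneg_left ?_ hq0.le
    linarith

/-- derivative of the total mass -/
lemma CrimeSol.dY (h : CrimeSol a b χ B1 B2 u0 v0 u v Tmax) (hab : a < b)
    (hB1 : HypB a b B1) (hB2 : HypB a b B2) {t : ℝ} (ht : t ∈ It' Tmax) :
    HasDerivAt (fun s => (∫ x in a..b, u x s) + ∫ x in a..b, v x s)
      ((∫ x in a..b, B1 x t) + (∫ x in a..b, B2 x t) - ∫ x in a..b, v x t) t :=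
  ((h.dU hab hB1 ht).add (h.dV hab hB2 ht)).congr_deriv (by ring)

lemma CrimeSol.near_zero_int (h : CrimeSol a b χ B1 B2 u0 v0 u v Tmax)
    (hinit : HypInit a b u0 v0) (hT : 0 < Tmax) (hab : a < b) :
    ∃ δ G : ℝ, 0 < δ ∧ 0 ≤ G ∧ ∀ t ∈ It' Tmax, t ≤ δ →
      (∫ x in a..b, u x t) ≤ G ∧ (∫ x in a..b, v x t) ≤ G ∧
      -G ≤ ∫ x in a..b, Real.log (v x t) := by
  obtain ⟨δ, K, k, hδ, hk, hb⟩ := h.near_zero hinit hT hab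
  have hba : 0 < b - a := sub_pos.2 hab
  refine ⟨δ, (|K| + |Real.log k|) * (b - a), hδ, by positivity, fun t ht htδ => ?_⟩
  have cu : ContinuousOn (fun x => u x t) (Set.Icc a b) := slice_cont h.cu ht
  have cv : ContinuousOn (fun x => v x t) (Set.Icc a b) := slice_cont h.cv ht
  have cl : ContinuousOn (fun x => Real.log (v x t)) (Set.Icc a b) :=
    cv.log fun x hx => (h.v_pos x hx t ht).ne'
  have hKK := le_abs_self K
  have hl0 := abs_nonneg (Real.log k)
  refine ⟨int_le_const hab cu fun x hx => ?_, int_le_const hab cv fun x hx => ?_, ?_⟩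
  · have := (hb t ht htδ x hx).1; linarith
  · have := (hb t ht htδ x hx).2.1; linarith
  · rw [← neg_mul]
    refine const_le_int hab cl fun x hx => ?_
    have h1 := Real.log_le_log hk (hb t ht htδ x hx).2.2
    have h2 := neg_abs_le (Real.log k)
    have h3 := abs_nonneg K
    linarith

/-- local-in-time bound of the mass -/
lemma CrimeSol.mass_local (h : CrimeSol a b χ B1 B2 u0 v0 u v Tmax)
    (hinit : HypInit a b u0 v0) (hT : 0 < Tmax) (hab : a < b)
    (hB1 : HypB a b B1) (hB2 : HypB a b B2) (T : ℝ) (hT0 : 0 < T) :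
    ∃ Y : ℝ, 0 ≤ Y ∧ ∀ t ∈ It' Tmax, t ≤ T → ∫ x in a..b, v x t ≤ Y := by
  obtain ⟨δ, G, hδ, hG, hb⟩ := h.near_zero_int hinit hT hab
  obtain ⟨M1, hM1, hM1'⟩ := hB1.exists_bound (Tmax := Tmax) hab
  obtain ⟨M2, hM2, hM2'⟩ := hB2.exists_bound (Tmax := Tmax) hab
  have := ode_bound (Tmax := Tmax)
    (g := fun s => ((∫ x in a..b, u x s) + ∫ x in a..b, v x s) - (M1 + M2) * s)
    (fun t ht => (h.dY hab hB1 hB2 ht).sub ((hasDerivAt_id t).const_mul (M1 + M2)))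
    (k := 0) (K := 0) (L := 2 * G) (by simp) ?_ hδ ?_
  · refine ⟨2 * G + (M1 + M2) * T, by positivity, fun t ht htT => ?_⟩
    have h1 := this t ht
    have h2 := h.intu_nonneg hab ht
    have h3 : (M1 + M2) * t ≤ (M1 + M2) * T := by gcongr
    linarith
  · intro t ht
    have h1 := hM1' t ht
    have h2 := hM2' t ht
    have h3 := h.intv_nonneg hab ht
    linarith
  · intro t ht htδ
    have h1 := hb t ht htδ
    have h2 : 0 ≤ (M1 + M2) * t := mul_nonneg (by linarith) ht.1.le
    linarith [h1.1, h1.2.1]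

/-- global bound of the mass under (H1) -/
lemma CrimeSol.mass_H1 (h : CrimeSol a b χ B1 B2 u0 v0 u v Tmax)
    (hinit : HypInit a b u0 v0) (hT : 0 < Tmax) (hab : a < b)
    (hB1 : HypB a b B1) (hB2 : HypB a b B2) (hH : HypH1 a b B1) :
    ∃ Y : ℝ, 0 ≤ Y ∧ ∀ t ∈ It' Tmax, ∫ x in a..b, v x t ≤ Y := by
  obtain ⟨δ, G, hδ, hG, hb⟩ := h.near_zero_int hinit hT hab
  obtain ⟨M2, hM2, hM2'⟩ := hB2.exists_bound (Tmax := Tmax) hab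
  obtain ⟨M, hM⟩ := hB1.2.1
  set g : ℝ → ℝ := fun s => ∫ x in Set.Ioo a b, B1 x s with hg
  have gint : IntegrableOn g (Set.Ioi 0) := by
    unfold HypH1 at hH
    rw [IntegrableOn, Measure.volume_eq_prod, ← Measure.prod_restrict] at hH
    exact hH.integral_prod_right
  have g0 : ∀ s, 0 ≤ g s := fun s => integral_nonneg fun x => hB1.1 x s
  have gcont : ContinuousOn g (Set.Ioi 0) := by
    refine continuousOn_of_dominated (bound := fun _ => M) ?_ ?_ (integrable_const M) ?_
    · intro s hs
      exact ((slice_cont hB1.cont (Set.mem_Ici.2 (le_of_lt hs))).mono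
        Set.Ioo_subset_Icc_self).aestronglyMeasurable measurableSet_Ioo
    · intro s hs
      refine Filter.Eventually.of_forall fun x => ?_
      rw [Real.norm_of_nonneg (hB1.1 x s)]; exact hM x s
    · refine (ae_restrict_iff' measurableSet_Ioo).2 (Filter.Eventually.of_forall fun x hx => ?_)
      have hc : ContinuousOn (fun s : ℝ => ((x, s) : ℝ × ℝ)) (Set.Ioi 0) := by fun_prop
      exact hB1.cont.comp hc fun s hs => ⟨Set.Ioo_subset_Icc_self hx, Set.mem_Ici.2 (le_of_lt hs)⟩
  set H : ℝ → ℝ := fun t => ∫ s in (0:ℝ)..t, g s with hHdef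
  have dH : ∀ t ∈ It' Tmax, HasDerivAt H (∫ x in a..b, B1 x t) t := by
    intro t ht
    have h1 : IntervalIntegrable g volume 0 t :=
      (intervalIntegrable_iff_integrableOn_Ioc_of_le ht.1.le).2
        (gint.mono_set Set.Ioc_subset_Ioi_self)
    have := intervalIntegral.integral_hasDerivAt_right h1
      (gcont.stronglyMeasurableAtFilter isOpen_Ioi t ht.1)
      (gcont.continuousAt (isOpen_Ioi.mem_nhds ht.1))
    exact this.congr_deriv (ioo_eq hab.le _)
  set S := ∫ s in Set.Ioi 0, g s with hS
  have H0 : ∀ t ∈ It' Tmax, 0 ≤ H t := fun t ht =>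
    intervalIntegral.integral_nonneg ht.1.le fun s _ => g0 s
  have HS : ∀ t ∈ It' Tmax, H t ≤ S := by
    intro t ht
    rw [hHdef, hS]
    simp only
    rw [intervalIntegral.integral_of_le ht.1.le]
    exact setIntegral_mono_set gint (Filter.Eventually.of_forall g0)
      (Filter.Eventually.of_forall (fun s hs => Set.Ioc_subset_Ioi_self hs))
  have hS0 : 0 ≤ S := integral_nonneg g0
  have uv0 : ∀ t ∈ It' Tmax, 0 ≤ ∫ x in a..b, u x t * v x t := fun t ht =>
    intervalIntegral.integral_nonneg hab.le fun x hx =>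
      mul_nonneg (h.u_pos x hx t ht).le (h.v_pos x hx t ht).le
  have hU := ode_bound (Tmax := Tmax)
    (g := fun s => (∫ x in a..b, u x s) - H s)
    (fun t ht => (h.dU hab hB1 ht).sub (dH t ht))
    (k := 0) (K := 0) (L := G) (by simp)
    (fun t ht => by linarith [uv0 t ht]) hδ
    (fun t ht htδ => by linarith [(hb t ht htδ).1, H0 t ht])
  have hY := ode_bound (Tmax := Tmax)
    (g := fun s => ((∫ x in a..b, u x s) + ∫ x in a..b, v x s) - H s)
    (fun t ht => (h.dY hab hB1 hB2 ht).sub (dH t ht))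
    (k := 1) (K := M2 + G + S) (L := 2 * G + M2 + S) (by linarith)
    (fun t ht => by
      have h1 := hU t ht
      linarith [hM2' t ht, H0 t ht, HS t ht]) hδ
    (fun t ht htδ => by linarith [(hb t ht htδ).1, (hb t ht htδ).2.1, H0 t ht])
  refine ⟨2 * G + M2 + 2 * S, by linarith, fun t ht => ?_⟩
  have h1 := hY t ht
  linarith [h.intu_nonneg hab ht, HS t ht]

/-- global bound of the mass under (H2) -/
lemma CrimeSol.mass_H2 (h : CrimeSol a b χ B1 B2 u0 v0 u v Tmax)
    (hinit : HypInit a b u0 v0) (hT : 0 < Tmax) (hab : a < b)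
    (hB1 : HypB a b B1) (hB2 : HypB a b B2) (hH : HypH2 a b B2) :
    ∃ Y : ℝ, 0 ≤ Y ∧ ∀ t ∈ It' Tmax, ∫ x in a..b, v x t ≤ Y := by
  obtain ⟨δ, G, hδ, hG, hb⟩ := h.near_zero_int hinit hT hab
  obtain ⟨M1, hM1, hM1'⟩ := hB1.exists_bound (Tmax := Tmax) hab
  obtain ⟨M2, hM2, hM2'⟩ := hB2.exists_bound (Tmax := Tmax) hab
  obtain ⟨c, hc, hcB⟩ := hH
  have hba : 0 < b - a := sub_pos.2 hab
  set A := (b - a) + c ^ 2 / 4 * (b - a) with hA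
  have hA0 : 0 ≤ A := by positivity
  have cvm : ∀ (r : ℝ), ∀ t ∈ It' Tmax, ContinuousOn (fun x => v x t ^ r) (Set.Icc a b) :=
    fun r t ht => slice_cont (f := fun x s => v x s ^ r) (h.cvp r) ht
  have cvx : ∀ t ∈ It' Tmax, ContinuousOn (fun x => pdx v x t) (Set.Icc a b) :=
    fun t ht => slice_cont (f := pdx v) h.v_cont21.fst ht
  have hB : ∀ t ∈ It' Tmax,
      -(c / (b - a)) * (∫ x in a..b, Real.log (v x t)) - c ^ 2 / 4 * (b - a)
        ≤ (∫ x in a..b, v x t ^ (-2 : ℝ) * pdx v x t ^ 2)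
          + ∫ x in a..b, v x t ^ (-1 : ℝ) * B2 x t := by
    intro t ht
    have cB : ContinuousOn (fun x => B2 x t) (Set.Icc a b) := CrimeSol.cBslice hB2 ht
    have cv : ContinuousOn (fun x => v x t) (Set.Icc a b) := slice_cont h.cv ht
    have cq : ContinuousOn (fun x => |pdx v x t / v x t|) (Set.Icc a b) :=
      ((cvx t ht).div cv fun x hx => (h.v_pos x hx t ht).ne').abs
    have hosc := log_osc hab (V := fun x => v x t) (V1 := fun x => pdx v x t)
      (fun x hx => (h.v_reg x hx t ht).1.hasDerivAt) (cvx t ht)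
      (fun x hx => h.v_pos x hx t ht)
    set Z := ∫ x in a..b, Real.log (v x t) with hZ
    set D := ∫ x in a..b, |pdx v x t / v x t| with hD
    set m := Real.exp (-(Z / (b - a) + D)) with hm
    have h1 : m * (∫ x in a..b, B2 x t) ≤ ∫ x in a..b, v x t ^ (-1 : ℝ) * B2 x t := by
      rw [← intervalIntegral.integral_const_mul]
      refine int_mono hab.le (cB.const_smul m) ((cvm (-1) t ht).mul cB) fun x hx => ?_
      refine mul_le_mul_of_nonneg_right ?_ (hB2.1 x t)
      rw [Real.rpow_neg_one]
      have hvp := h.v_pos x hx t ht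
      rw [← Real.exp_log (inv_pos.2 hvp), Real.log_inv, hm]
      exact Real.exp_le_exp.2 (neg_le_neg (hosc x hx))
    have h2 : m * c ≤ m * (∫ x in a..b, B2 x t) := by
      refine mul_le_mul_of_nonneg_left ?_ (Real.exp_pos _).le
      rw [← ioo_eq hab.le]; exact hcB t ht.1
    have h3 : -(Z / (b - a) + D) ≤ m := by
      have := Real.add_one_le_exp (-(Z / (b - a) + D)); linarith
    have h4 : -(Z / (b - a) + D) * c ≤ m * c := mul_le_mul_of_nonneg_right h3 hc.le
    have h5 : c * D - c ^ 2 / 4 * (b - a) ≤ ∫ x in a..b, v x t ^ (-2 : ℝ) * pdx v x t ^ 2 := by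
      have e : c * D - c ^ 2 / 4 * (b - a)
          = ∫ x in a..b, (c * |pdx v x t / v x t| - c ^ 2 / 4) := by
        rw [intervalIntegral.integral_sub ((ii_of_cont hab.le cq).const_mul c)
          intervalIntegrable_const, intervalIntegral.integral_const_mul,
          intervalIntegral.integral_const, smul_eq_mul, ← hD]
        ring
      rw [e]
      refine int_mono hab.le ((cq.const_smul c).sub continuousOn_const)
        ((cvm (-2) t ht).mul ((cvx t ht).pow 2)) fun x hx => ?_
      have hvp := h.v_pos x hx t ht
      have e2 : v x t ^ (-2 : ℝ) * pdx v x t ^ 2 = |pdx v x t / v x t| ^ 2 := by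
        rw [sq_abs, div_pow, Real.rpow_neg hvp.le]
        norm_num
        field_simp
      rw [e2]
      nlinarith [sq_nonneg (|pdx v x t / v x t| - c / 2)]
    have e6 : -(Z / (b - a) + D) * c = -(c / (b - a)) * Z - c * D := by ring
    linarith
  have hZ := ode_bound (Tmax := Tmax)
    (g := fun s => -(∫ x in a..b, Real.log (v x s)))
    (fun t ht => (h.dZ hab hB2 ht).neg)
    (k := c / (b - a)) (K := A) (L := G + A / (c / (b - a)))
    (by
      have : 0 < c / (b - a) := by positivity
      rw [mul_add, mul_div_cancel₀ _ this.ne']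
      have := mul_nonneg this.le hG
      linarith)
    (fun t ht => by
      have h1 := hB t ht
      have h2 := h.intu_nonneg hab ht
      linarith) hδ
    (fun t ht htδ => by
      have h1 := (hb t ht htδ).2.2
      have : 0 ≤ A / (c / (b - a)) := by positivity
      linarith)
  set CZ := G + A / (c / (b - a)) with hCZ
  have hCZ0 : 0 ≤ CZ := by positivity
  have hW := ode_bound (Tmax := Tmax)
    (g := fun s => ((∫ x in a..b, u x s) + ∫ x in a..b, v x s)
      - (1 / 2) * (∫ x in a..b, Real.log (v x s)))
    (fun t ht => (h.dY hab hB1 hB2 ht).sub ((h.dZ hab hB2 ht).const_mul (1 / 2)))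
    (k := 1 / 2) (K := M1 + M2 + (b - a) / 2 + CZ / 4)
    (L := 3 * G + 2 * (M1 + M2 + (b - a) / 2 + CZ / 4)) (by linarith)
    (fun t ht => by
      have h1 := hZ t ht
      have h2 := h.intu_nonneg hab ht
      have h3 := h.intv_nonneg hab ht
      have h4 := hM1' t ht
      have h5 := hM2' t ht
      have h6 : 0 ≤ ∫ x in a..b, v x t ^ (-2 : ℝ) * pdx v x t ^ 2 :=
        intervalIntegral.integral_nonneg hab.le fun x hx =>
          mul_nonneg (Real.rpow_nonneg (h.v_pos x hx t ht).le _) (sq_nonneg _)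
      have h7 : 0 ≤ ∫ x in a..b, v x t ^ (-1 : ℝ) * B2 x t :=
        intervalIntegral.integral_nonneg hab.le fun x hx =>
          mul_nonneg (Real.rpow_nonneg (h.v_pos x hx t ht).le _) (hB2.1 x t)
      linarith) hδ
    (fun t ht htδ => by
      obtain ⟨h1, h2, h3⟩ := hb t ht htδ
      linarith)
  refine ⟨2 * (3 * G + 2 * (M1 + M2 + (b - a) / 2 + CZ / 4)), by positivity, fun t ht => ?_⟩
  have h1 := hW t ht
  have h2 := h.intu_nonneg hab ht
  have cv : ContinuousOn (fun x => v x t) (Set.Icc a b) := slice_cont h.cv ht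
  have h3 : ∫ x in a..b, Real.log (v x t) ≤ ∫ x in a..b, v x t := by
    refine int_mono hab.le (cv.log fun x hx => (h.v_pos x hx t ht).ne') cv fun x hx => ?_
    exact Real.log_le_self (h.v_pos x hx t ht).le
  linarith

end sol

lemma tauOf_nonneg (Tmax : ℝ≥0∞) : 0 ≤ tauOf Tmax := ENNReal.toReal_nonneg

lemma tauOf_le_one (Tmax : ℝ≥0∞) : tauOf Tmax ≤ 1 := by
  have := ENNReal.toReal_mono ENNReal.one_ne_top (min_le_left 1 (Tmax / 3))
  simpa [tauOf] using this

/-- Lemma 3.1 (spatio-temporal bound on `∫∫ v^{q−2} v_x²` for `q ∈ (0,1)`). -/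
theorem weighted_gradient_bound_for_v
    (a b χ : ℝ) (hab : a < b) (hχ : 0 < χ)
    (B1 B2 : ℝ → ℝ → ℝ) (hB1 : HypB a b B1) (hB2 : HypB a b B2)
    (u0 v0 : ℝ → ℝ) (hinit : HypInit a b u0 v0)
    (Tmax : ℝ≥0∞) (hT : 0 < Tmax)
    (u v : ℝ → ℝ → ℝ) (hsol : CrimeSol a b χ B1 B2 u0 v0 u v Tmax)
    (q : ℝ) (hq : q ∈ Set.Ioo (0:ℝ) 1) :
    (∀ T : ℝ, 0 < T → ∃ C : ℝ, 0 < C ∧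
      ∀ t : ℝ, 0 < t →
        ENNReal.ofReal (t + tauOf Tmax) < min (ENNReal.ofReal T) Tmax →
        (∫ s in t..(t + tauOf Tmax),
            ∫ x in Set.Ioo a b, v x s ^ (q - 2) * (pdx v x s) ^ 2) ≤ C) ∧
    ((HypH1 a b B1 ∨ HypH2 a b B2) → ∃ C : ℝ, 0 < C ∧
      ∀ t : ℝ, 0 < t → ENNReal.ofReal (t + tauOf Tmax) < Tmax →
        (∫ s in t..(t + tauOf Tmax),
            ∫ x in Set.Ioo a b, v x s ^ (q - 2) * (pdx v x s) ^ 2) ≤ C) := by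
  have hqq : 0 < q * (1 - q) := mul_pos hq.1 (by linarith [hq.2])
  have hba : 0 < b - a := sub_pos.2 hab
  have hτ := tauOf_nonneg Tmax
  have hτ1 := tauOf_le_one Tmax
  refine ⟨fun T hT0 => ?_, fun hH => ?_⟩
  · obtain ⟨Y, hY0, hY⟩ := hsol.mass_local hinit hT hab hB1 hB2 T hT0
    refine ⟨2 * ((b - a) + Y) / (q * (1 - q)), by positivity, fun t ht htt => ?_⟩
    have hmem : t + tauOf Tmax ∈ It' Tmax := ⟨by linarith, lt_of_lt_of_le htt (min_le_right _ _)⟩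
    have hle : t + tauOf Tmax < T :=
      (ENNReal.ofReal_lt_ofReal_iff hT0).1 (lt_of_lt_of_le htt (min_le_left _ _))
    exact hsol.core hab hB2 hq ht hτ hτ1 hmem hY0 fun s hs =>
      hY s (It'_of_le (lt_of_lt_of_le ht hs.1) hs.2 hmem) (hs.2.trans hle.le)
  · obtain ⟨Y, hY0, hY⟩ : ∃ Y : ℝ, 0 ≤ Y ∧ ∀ t ∈ It' Tmax, ∫ x in a..b, v x t ≤ Y := by
      rcases hH with hH | hH
      · exact hsol.mass_H1 hinit hT hab hB1 hB2 hH
      · exact hsol.mass_H2 hinit hT hab hB1 hB2 hH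
    refine ⟨2 * ((b - a) + Y) / (q * (1 - q)), by positivity, fun t ht htt => ?_⟩
    have hmem : t + tauOf Tmax ∈ It' Tmax := ⟨by linarith, htt⟩
    exact hsol.core hab hB2 hq ht hτ hτ1 hmem hY0 fun s hs =>
      hY s (It'_of_le (lt_of_lt_of_le ht hs.1) hs.2 hmem)
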